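/- arXiv:2011.00358 — 2 statements merged into one kernel-verified Lean document; each statement's English description precedes it below -/
import Mathlib

section
/- Let n ≥ 2. Suppose w : ℝ^{n−1} × ℝ → ℝ is a C² function which is bounded together with its first and second partial derivatives, f : ℝ^{n−1} → ℝ is continuous, and for every (y,z) one has Δ_{ℝ^{n−1}} w(y,z) + ∂_z² w(y,z) − W''(ℍ(z)) w(y,z) = f(y) ℍ'(z). Then the function c(y) := 𝔢₀^{−1} ∫_ℝ w(y,z) ℍ'(z) dz is C² on ℝ^{n−1} and satisfies Δ_{ℝ^{n−1}} c = f. -/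
open MeasureTheory Filter

/-- The Euclidean Laplacian of a function on `ℝ^k` (as `Fin k → ℝ`). -/
noncomputable def lapPi {k : ℕ} (c : (Fin k → ℝ) → ℝ) (y : Fin k → ℝ) : ℝ :=
  ∑ i, iteratedDeriv 2 (fun t => c (Function.update y i t)) (y i)

section ParametricIntegral

variable {E : Type*} [NormedAddCommGroup E]
  {G : E × ℝ → ℝ} {g : ℝ → ℝ} {M M' : ℝ}

theorem integrable_slice_mul (hG : Continuous G) (hM : ∀ p, ‖G p‖ ≤ M) (hg : Integrable g) (y : E) :
    Integrable (fun z => G (y, z) * g z) :=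
  hg.bdd_mul (by fun_prop : Continuous fun z => G (y, z)).aestronglyMeasurable
    (ae_of_all _ fun z => hM (y, z))

theorem continuous_integral_slice_mul (hG : Continuous G) (hM : ∀ p, ‖G p‖ ≤ M)
    (hg : Integrable g) : Continuous fun y : E => ∫ z, G (y, z) * g z := by
  refine continuous_of_dominated (bound := fun z => M * ‖g z‖)
    (fun y => (integrable_slice_mul hG hM hg y).aestronglyMeasurable)
    (fun y => ae_of_all _ fun z => ?_) (hg.norm.const_mul M) (ae_of_all _ fun z => by fun_prop)
  rw [norm_mul]
  gcongr
  exact hM _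

variable [NormedSpace ℝ E]

theorem hasFDerivAt_integral_slice_mul (hG : ContDiff ℝ 1 G) (hM : ∀ p, ‖G p‖ ≤ M)
    (hM' : ∀ p, ‖fderiv ℝ G p‖ ≤ M') (hg : Integrable g) (y : E) :
    HasFDerivAt (fun y => ∫ z, G (y, z) * g z)
      (∫ z, g z • (fderiv ℝ G (y, z)).comp (.inl ℝ E ℝ)) y := by
  have hcont : Continuous (fderiv ℝ G) := hG.continuous_fderiv one_ne_zero
  refine hasFDerivAt_integral_of_dominated_of_fderiv_le
    (F' := fun y z => g z • (fderiv ℝ G (y, z)).comp (.inl ℝ E ℝ))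
    (bound := fun z => ‖g z‖ * (M' * ‖ContinuousLinearMap.inl ℝ E ℝ‖)) univ_mem
    (Eventually.of_forall fun y => (integrable_slice_mul hG.continuous hM hg y).aestronglyMeasurable)
    (integrable_slice_mul hG.continuous hM hg y) ?_
    (ae_of_all _ fun z x _ => ?_) (hg.norm.mul_const _) (ae_of_all _ fun z x _ => ?_)
  · exact hg.aestronglyMeasurable.smul
      (by fun_prop : Continuous fun z => (fderiv ℝ G (y, z)).comp (.inl ℝ E ℝ)).aestronglyMeasurable
  · rw [norm_smul]
    gcongr
    refine (ContinuousLinearMap.opNorm_comp_le _ _).trans ?_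
    gcongr
    exact hM' _
  · have h1 : HasFDerivAt (fun x : E => (x, z)) (.inl ℝ E ℝ) x := hasFDerivAt_prodMk_left x z
    have h2 := (hG.differentiable one_ne_zero (x, z)).hasFDerivAt
    exact (h2.comp x h1).mul_const (g z)

theorem fderiv_integral_slice_mul_apply (hG : ContDiff ℝ 1 G) (hM : ∀ p, ‖G p‖ ≤ M)
    (hM' : ∀ p, ‖fderiv ℝ G p‖ ≤ M') (hg : Integrable g) (y v : E) :
    fderiv ℝ (fun y => ∫ z, G (y, z) * g z) y v = ∫ z, fderiv ℝ G (y, z) (v, 0) * g z := by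
  have hcont : Continuous (fderiv ℝ G) := hG.continuous_fderiv one_ne_zero
  have hint : Integrable fun z => g z • (fderiv ℝ G (y, z)).comp (.inl ℝ E ℝ) := by
    refine hg.smul_bdd (M' * ‖ContinuousLinearMap.inl ℝ E ℝ‖)
      (by fun_prop : Continuous fun z => (fderiv ℝ G (y, z)).comp (.inl ℝ E ℝ)).aestronglyMeasurable
      (ae_of_all _ fun z => (ContinuousLinearMap.opNorm_comp_le _ _).trans ?_)
    gcongr
    exact hM' _
  rw [(hasFDerivAt_integral_slice_mul hG hM hM' hg y).fderiv,
    ContinuousLinearMap.integral_apply hint]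
  simp [mul_comm]

theorem norm_fderiv_apply_le (hM' : ∀ p, ‖fderiv ℝ G p‖ ≤ M') (v : E × ℝ) (p : E × ℝ) :
    ‖fderiv ℝ G p v‖ ≤ M' * ‖v‖ :=
  (fderiv ℝ G p).le_of_opNorm_le (hM' p) v

theorem contDiff_one_integral_slice_mul [FiniteDimensional ℝ E] (hG : ContDiff ℝ 1 G)
    (hM : ∀ p, ‖G p‖ ≤ M) (hM' : ∀ p, ‖fderiv ℝ G p‖ ≤ M') (hg : Integrable g) :
    ContDiff ℝ 1 fun y => ∫ z, G (y, z) * g z := by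
  have hcont : Continuous (fderiv ℝ G) := hG.continuous_fderiv one_ne_zero
  rw [← zero_add 1, contDiff_succ_iff_fderiv_apply]
  refine ⟨fun y => (hasFDerivAt_integral_slice_mul hG hM hM' hg y).differentiableAt, by simp,
    fun v => ?_⟩
  simp_rw [fderiv_integral_slice_mul_apply hG hM hM' hg, contDiff_zero]
  exact continuous_integral_slice_mul (G := fun p => fderiv ℝ G p (v, 0)) (by fun_prop)
    (norm_fderiv_apply_le hM' (v, 0)) hg

theorem contDiff_fderiv_apply_one (hG : ContDiff ℝ 2 G) (v : E × ℝ) :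
    ContDiff ℝ 1 fun p => fderiv ℝ G p v :=
  (hG.fderiv_right (by norm_num)).clm_apply contDiff_const

theorem fderiv_fderiv_apply (hG : ContDiff ℝ 2 G) (u v p : E × ℝ) :
    fderiv ℝ (fun p => fderiv ℝ G p v) p u = fderiv ℝ (fderiv ℝ G) p u v := by
  have h : DifferentiableAt ℝ (fderiv ℝ G) p :=
    (hG.fderiv_right (m := 1) (by norm_num)).differentiable one_ne_zero p
  rw [fderiv_clm_apply h (by fun_prop)]
  simp

theorem norm_fderiv_fderiv_apply_le (hG : ContDiff ℝ 2 G)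
    (hM' : ∀ p, ‖fderiv ℝ (fderiv ℝ G) p‖ ≤ M') (v p : E × ℝ) :
    ‖fderiv ℝ (fun p => fderiv ℝ G p v) p‖ ≤ M' * ‖v‖ := by
  have hM0 : 0 ≤ M' := (norm_nonneg (fderiv ℝ (fderiv ℝ G) p)).trans (hM' p)
  refine ContinuousLinearMap.opNorm_le_bound _ (by positivity) fun u => ?_
  rw [fderiv_fderiv_apply hG]
  calc ‖fderiv ℝ (fderiv ℝ G) p u v‖ ≤ ‖fderiv ℝ (fderiv ℝ G) p‖ * ‖u‖ * ‖v‖ :=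
        ContinuousLinearMap.le_opNorm₂ _ u v
    _ ≤ M' * ‖u‖ * ‖v‖ := by gcongr; exact hM' p
    _ = M' * ‖v‖ * ‖u‖ := by ring

theorem contDiff_two_integral_slice_mul [FiniteDimensional ℝ E] {M₂ : ℝ} (hG : ContDiff ℝ 2 G)
    (hM : ∀ p, ‖G p‖ ≤ M) (hM' : ∀ p, ‖fderiv ℝ G p‖ ≤ M')
    (hM₂ : ∀ p, ‖fderiv ℝ (fderiv ℝ G) p‖ ≤ M₂) (hg : Integrable g) :
    ContDiff ℝ 2 fun y => ∫ z, G (y, z) * g z := by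
  have hG1 : ContDiff ℝ 1 G := hG.of_le (by norm_num)
  rw [← one_add_one_eq_two, contDiff_succ_iff_fderiv_apply]
  refine ⟨fun y => (hasFDerivAt_integral_slice_mul hG1 hM hM' hg y).differentiableAt, by simp,
    fun v => ?_⟩
  simp_rw [fderiv_integral_slice_mul_apply hG1 hM hM' hg]
  exact contDiff_one_integral_slice_mul (contDiff_fderiv_apply_one hG (v, 0))
    (norm_fderiv_apply_le hM' (v, 0)) (norm_fderiv_fderiv_apply_le hG hM₂ (v, 0)) hg

theorem fderiv_fderiv_integral_slice_mul {M₂ : ℝ} (hG : ContDiff ℝ 2 G)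
    (hM : ∀ p, ‖G p‖ ≤ M) (hM' : ∀ p, ‖fderiv ℝ G p‖ ≤ M')
    (hM₂ : ∀ p, ‖fderiv ℝ (fderiv ℝ G) p‖ ≤ M₂) (hg : Integrable g) (y v : E) :
    fderiv ℝ (fun y => fderiv ℝ (fun y => ∫ z, G (y, z) * g z) y v) y v =
      ∫ z, fderiv ℝ (fderiv ℝ G) (y, z) (v, 0) (v, 0) * g z := by
  simp_rw [fderiv_integral_slice_mul_apply (hG.of_le (by norm_num)) hM hM' hg]
  rw [fderiv_integral_slice_mul_apply (G := fun p => fderiv ℝ G p (v, 0))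
    (contDiff_fderiv_apply_one hG (v, 0))
    (norm_fderiv_apply_le hM' (v, 0)) (norm_fderiv_fderiv_apply_le hG hM₂ (v, 0)) hg]
  simp_rw [fderiv_fderiv_apply hG]

theorem integrable_fderiv_fderiv_slice_mul (hG : ContDiff ℝ 2 G)
    (hM : ∀ p, ‖fderiv ℝ (fderiv ℝ G) p‖ ≤ M) (hg : Integrable g) (y : E) (u : E × ℝ) :
    Integrable fun z => fderiv ℝ (fderiv ℝ G) (y, z) u u * g z := by
  have hc : Continuous (fderiv ℝ (fderiv ℝ G)) :=
    (hG.fderiv_right (m := 1) (by norm_num)).continuous_fderiv one_ne_zero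
  refine integrable_slice_mul (G := fun p => fderiv ℝ (fderiv ℝ G) p u u)
    (M := M * ‖u‖ * ‖u‖) (by fun_prop) (fun p => ?_) hg y
  refine (ContinuousLinearMap.le_opNorm₂ _ u u).trans ?_
  gcongr
  exact hM p

theorem fderiv_slice_apply (hG : Differentiable ℝ G) (z : ℝ) (y v : E) :
    fderiv ℝ (fun y => G (y, z)) y v = fderiv ℝ G (y, z) (v, 0) := by
  have h : HasFDerivAt (fun x : E => (x, z)) (.inl ℝ E ℝ) y := hasFDerivAt_prodMk_left y z
  have h' : HasFDerivAt (fun y => G (y, z)) ((fderiv ℝ G (y, z)).comp (.inl ℝ E ℝ)) y :=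
    (hG (y, z)).hasFDerivAt.comp y h
  rw [h'.fderiv]
  simp

theorem fderiv_fderiv_slice_apply (hG : ContDiff ℝ 2 G) (z : ℝ) (y v : E) :
    fderiv ℝ (fun y => fderiv ℝ (fun y => G (y, z)) y v) y v =
      fderiv ℝ (fderiv ℝ G) (y, z) (v, 0) (v, 0) := by
  simp_rw [fderiv_slice_apply (hG.differentiable two_ne_zero)]
  rw [fderiv_slice_apply (G := fun p => fderiv ℝ G p (v, 0))
    ((contDiff_fderiv_apply_one hG (v, 0)).differentiable one_ne_zero), fderiv_fderiv_apply hG]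

theorem hasDerivAt_vertical (hG : Differentiable ℝ G) (y : E) (z : ℝ) :
    HasDerivAt (fun z => G (y, z)) (fderiv ℝ G (y, z) (0, 1)) z :=
  (hG (y, z)).hasFDerivAt.comp_hasDerivAt z ((hasDerivAt_const z y).prodMk (hasDerivAt_id z))

theorem hasDerivAt_vertical_fderiv (hG : ContDiff ℝ 2 G) (y : E) (z : ℝ) :
    HasDerivAt (fun z => fderiv ℝ G (y, z) (0, 1))
      (fderiv ℝ (fderiv ℝ G) (y, z) (0, 1) (0, 1)) z := by
  rw [← fderiv_fderiv_apply hG]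
  exact hasDerivAt_vertical (G := fun p => fderiv ℝ G p (0, 1))
    ((contDiff_fderiv_apply_one hG (0, 1)).differentiable one_ne_zero) y z

theorem iteratedDeriv_two_vertical (hG : ContDiff ℝ 2 G) (y : E) (z : ℝ) :
    iteratedDeriv 2 (fun z => G (y, z)) z = fderiv ℝ (fderiv ℝ G) (y, z) (0, 1) (0, 1) := by
  have h : deriv (fun z => G (y, z)) = fun z => fderiv ℝ G (y, z) (0, 1) :=
    funext fun z => (hasDerivAt_vertical (hG.differentiable two_ne_zero) y z).deriv
  rw [iteratedDeriv_succ, iteratedDeriv_one, h, (hasDerivAt_vertical_fderiv hG y z).deriv]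

end ParametricIntegral

theorem hasDerivAt_comp_update {k : ℕ} {h : (Fin k → ℝ) → ℝ} (hh : Differentiable ℝ h)
    (y : Fin k → ℝ) (i : Fin k) (t : ℝ) :
    HasDerivAt (fun t => h (Function.update y i t))
      (fderiv ℝ h (Function.update y i t) (Pi.single i 1)) t :=
  (hh _).hasFDerivAt.comp_hasDerivAt t (hasDerivAt_update y i t)

theorem lapPi_eq_sum_fderiv {k : ℕ} {h : (Fin k → ℝ) → ℝ} (hh : ContDiff ℝ 2 h)
    (y : Fin k → ℝ) :
    lapPi h y = ∑ i, fderiv ℝ (fun x => fderiv ℝ h x (Pi.single i 1)) y (Pi.single i 1) := by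
  refine Finset.sum_congr rfl fun i _ => ?_
  have hd : deriv (fun t => h (Function.update y i t)) =
      fun t => fderiv ℝ h (Function.update y i t) (Pi.single i 1) :=
    funext fun t => (hasDerivAt_comp_update (hh.differentiable two_ne_zero) y i t).deriv
  have hd' : ContDiff ℝ 1 fun x => fderiv ℝ h x (Pi.single i 1) :=
    (hh.fderiv_right (by norm_num)).clm_apply contDiff_const
  rw [iteratedDeriv_succ, iteratedDeriv_one, hd,
    (hasDerivAt_comp_update (hd'.differentiable one_ne_zero) y i (y i)).deriv,
    Function.update_eq_self]

theorem lapPi_slice {k : ℕ} {G : (Fin k → ℝ) × ℝ → ℝ} (hG : ContDiff ℝ 2 G)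
    (y : Fin k → ℝ) (z : ℝ) :
    lapPi (fun y => G (y, z)) y =
      ∑ i, fderiv ℝ (fderiv ℝ G) (y, z) (Pi.single i 1, 0) (Pi.single i 1, 0) := by
  rw [lapPi_eq_sum_fderiv (by fun_prop)]
  simp_rw [fderiv_fderiv_slice_apply hG]

theorem lapPi_const_mul {k : ℕ} (h : (Fin k → ℝ) → ℝ) (a : ℝ)
    (y : Fin k → ℝ) : lapPi (fun x => a * h x) y = a * lapPi h y := by
  rw [lapPi, lapPi, Finset.mul_sum]
  refine Finset.sum_congr rfl fun i _ => iteratedDeriv_const_mul_field a _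

theorem lapPi_integral_slice_mul {k : ℕ} {G : (Fin k → ℝ) × ℝ → ℝ} {g : ℝ → ℝ} {M M' M₂ : ℝ}
    (hG : ContDiff ℝ 2 G) (hM : ∀ p, ‖G p‖ ≤ M) (hM' : ∀ p, ‖fderiv ℝ G p‖ ≤ M')
    (hM₂ : ∀ p, ‖fderiv ℝ (fderiv ℝ G) p‖ ≤ M₂) (hg : Integrable g) (y : Fin k → ℝ) :
    lapPi (fun y => ∫ z, G (y, z) * g z) y = ∫ z, lapPi (fun y => G (y, z)) y * g z := by
  rw [lapPi_eq_sum_fderiv (contDiff_two_integral_slice_mul hG hM hM' hM₂ hg)]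
  simp_rw [lapPi_slice hG, Finset.sum_mul, fderiv_fderiv_integral_slice_mul hG hM hM' hM₂ hg]
  rw [integral_finsetSum]
  exact fun i _ => integrable_fderiv_fderiv_slice_mul hG hM₂ hg y _

theorem integrable_exp_neg_mul_abs {a : ℝ} (ha : 0 < a) :
    Integrable fun t : ℝ => Real.exp (-a * |t|) := by
  rw [← integrableOn_univ, ← Set.Iic_union_Ioi (a := (0 : ℝ)), integrableOn_union]
  constructor
  · refine (integrableOn_exp_mul_Iic ha 0).congr_fun (fun t ht => ?_) measurableSet_Iic
    simp [abs_of_nonpos (Set.mem_Iic.1 ht)]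
  · refine (integrableOn_exp_mul_Ioi (neg_neg_of_pos ha) 0).congr_fun (fun t ht => ?_)
      measurableSet_Ioi
    simp [abs_of_pos (Set.mem_Ioi.1 ht)]

theorem tendsto_exp_neg_mul_abs {a : ℝ} (ha : 0 < a) {l : Filter ℝ}
    (hl : Tendsto (fun t : ℝ => |t|) l atTop) :
    Tendsto (fun t : ℝ => Real.exp (-a * |t|)) l (nhds 0) :=
  Real.tendsto_exp_atBot.comp (hl.const_mul_atTop_of_neg (neg_neg_of_pos ha))

/-- for a C² solution of
`Δ_{ℝ^{n-1}} w + ∂_z² w − W''(ℍ(z)) w = f(y) ℍ'(z)` which is bounded together with its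
first and second derivatives, the projection `c(y) = 𝔢₀⁻¹ ∫ w(y,z) ℍ'(z) dz` is C² and
satisfies `Δ_{ℝ^{n-1}} c = f`. -/
theorem projection_onto_Hprime_solves_laplace
    (n : ℕ) (hn : 2 ≤ n)
    (W ℍ : ℝ → ℝ)
    (hWsmooth : ContDiff ℝ (⊤ : ℕ∞) W)
    (hWnonneg : ∀ x, 0 ≤ W x)
    (hWzero : ∀ x, W x = 0 ↔ x = 1 ∨ x = -1)
    (hW'zero : deriv W 0 = 0)
    (hW''zero : iteratedDeriv 2 W 0 ≠ 0)
    (hWwell : ∀ x : ℝ, 0 < |x| → |x| < 1 → x * deriv W x < 0)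
    (hWconv : ∃ κ > (0:ℝ), ∃ β ∈ Set.Ioo (0:ℝ) 1, ∀ x : ℝ, 1 - β ≤ |x| → κ ≤ iteratedDeriv 2 W x)
    (hWsymm : ∀ x, W (-x) = W x)
    (hHsmooth : ContDiff ℝ (⊤ : ℕ∞) ℍ)
    (hHrange : ∀ t, ℍ t ∈ Set.Ioo (-1:ℝ) 1)
    (hHode : ∀ t, iteratedDeriv 2 ℍ t = deriv W (ℍ t))
    (hHzero : ℍ 0 = 0)
    (hHmono : ∀ t, 0 < deriv ℍ t)
    (hHtop : Filter.Tendsto ℍ Filter.atTop (nhds 1))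
    (hHbot : Filter.Tendsto ℍ Filter.atBot (nhds (-1)))
    (hdecay : ∃ C > (0:ℝ), ∃ a > (0:ℝ), ∀ t : ℝ,
      |deriv ℍ t| + |iteratedDeriv 2 ℍ t| ≤ C * Real.exp (-a * |t|))
    (w : (Fin (n - 1) → ℝ) → ℝ → ℝ)
    (hw : ContDiff ℝ 2 (fun p : (Fin (n - 1) → ℝ) × ℝ => w p.1 p.2))
    (hwB : ∀ j : ℕ, j ≤ 2 → ∃ M : ℝ, ∀ p : (Fin (n - 1) → ℝ) × ℝ,
      ‖iteratedFDeriv ℝ j (fun q : (Fin (n - 1) → ℝ) × ℝ => w q.1 q.2) p‖ ≤ M)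
    (f : (Fin (n - 1) → ℝ) → ℝ)
    (hf : Continuous f)
    (hpde : ∀ y z, lapPi (fun y' => w y' z) y + iteratedDeriv 2 (w y) z
        - iteratedDeriv 2 W (ℍ z) * w y z = f y * deriv ℍ z) :
    ContDiff ℝ 2
        (fun y => (∫ t : ℝ, (deriv ℍ t) ^ 2)⁻¹ * ∫ z : ℝ, w y z * deriv ℍ z) ∧
      ∀ y, lapPi
        (fun y' => (∫ t : ℝ, (deriv ℍ t) ^ 2)⁻¹ * ∫ z : ℝ, w y' z * deriv ℍ z) y = f y := by
  obtain ⟨C, hC, a, ha, hdec⟩ := hdecay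
  obtain ⟨M, hM⟩ := hwB 0 (by norm_num)
  obtain ⟨M', hM'⟩ := hwB 1 (by norm_num)
  obtain ⟨M₂, hM₂⟩ := hwB 2 le_rfl
  set G : (Fin (n - 1) → ℝ) × ℝ → ℝ := fun p => w p.1 p.2
  simp_rw [norm_iteratedFDeriv_zero] at hM
  simp_rw [norm_iteratedFDeriv_one] at hM'
  simp_rw [← norm_iteratedFDeriv_fderiv (n := 1), norm_iteratedFDeriv_one] at hM₂
  have hdH : ContDiff ℝ 2 (deriv ℍ) :=
    ((contDiff_infty_iff_deriv.1 hHsmooth).2).of_le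
      (WithTop.coe_le_coe.2 le_top)
  have hddH : deriv (deriv ℍ) = fun t => deriv W (ℍ t) := by
    funext t
    rw [← hHode t, iteratedDeriv_succ, iteratedDeriv_one]
  have hdHle : ∀ t, |deriv ℍ t| ≤ C * Real.exp (-a * |t|) := fun t =>
    (le_add_of_nonneg_right (abs_nonneg _)).trans (hdec t)
  have hddHle : ∀ t, |deriv W (ℍ t)| ≤ C * Real.exp (-a * |t|) := fun t => by
    rw [← hHode t]
    exact (le_add_of_nonneg_left (abs_nonneg _)).trans (hdec t)
  have hexp := (integrable_exp_neg_mul_abs ha).const_mul C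
  have hg : Integrable (deriv ℍ) :=
    hexp.mono' hdH.continuous.aestronglyMeasurable (ae_of_all _ hdHle)
  have hsq : Integrable fun t => deriv ℍ t ^ 2 := by
    simp_rw [sq]
    refine hg.bdd_mul (c := C) hdH.continuous.aestronglyMeasurable
      (ae_of_all _ fun t => (hdHle t).trans ?_)
    exact mul_le_of_le_one_right hC.le
      (Real.exp_le_one_iff.2 (by nlinarith [abs_nonneg t]))
  have hpos : 0 < ∫ t, deriv ℍ t ^ 2 := by
    rw [integral_pos_iff_support_of_nonneg (fun t => sq_nonneg _) hsq]
    have : Function.support (fun t => deriv ℍ t ^ 2) = Set.univ :=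
      Set.eq_univ_of_forall fun t => (pow_pos (hHmono t) 2).ne'
    simp [this]
  have hc2 : ContDiff ℝ 2 fun y => ∫ z, w y z * deriv ℍ z :=
    contDiff_two_integral_slice_mul (G := G) hw hM hM' hM₂ hg
  refine ⟨contDiff_const.mul hc2, fun y => ?_⟩
  rw [lapPi_const_mul, inv_mul_eq_iff_eq_mul₀ hpos.ne',
    lapPi_integral_slice_mul (G := G) hw hM hM' hM₂ hg y]
  have hW2 : ∀ x, HasDerivAt (deriv W) (iteratedDeriv 2 W x) x := fun x => by
    rw [iteratedDeriv_succ, iteratedDeriv_one]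
    exact ((contDiff_infty_iff_deriv.1 hWsmooth).2.differentiable (by simp) x).hasDerivAt
  have hH1 : ∀ t, HasDerivAt ℍ (deriv ℍ t) t := fun t =>
    (hHsmooth.differentiable (by simp) t).hasDerivAt
  have hH2 : ∀ t, HasDerivAt (deriv ℍ) (deriv W (ℍ t)) t := fun t => by
    rw [← congrFun hddH t]
    exact (hdH.differentiable two_ne_zero t).hasDerivAt
  have hH3 : ∀ t, HasDerivAt (fun t => deriv W (ℍ t)) (iteratedDeriv 2 W (ℍ t) * deriv ℍ t) t :=
    fun t => (hW2 (ℍ t)).comp t (hH1 t)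
  have hW2c : Continuous (iteratedDeriv 2 W) :=
    hWsmooth.continuous_iteratedDeriv 2 (WithTop.coe_le_coe.2 le_top)
  obtain ⟨K, hK⟩ := (isCompact_Icc (a := (-1 : ℝ)) (b := 1)).exists_bound_of_continuousOn
    hW2c.continuousOn
  have hi1 : Integrable fun z => iteratedDeriv 2 (w y) z * deriv ℍ z := by
    have h := integrable_fderiv_fderiv_slice_mul (G := G) hw hM₂ hg y (0, 1)
    simp_rw [← iteratedDeriv_two_vertical (G := G) hw y] at h
    exact h
  have hi2 : Integrable fun z => w y z * (iteratedDeriv 2 W (ℍ z) * deriv ℍ z) := by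
    refine integrable_slice_mul (G := G) (M := M) hw.continuous hM ?_ y
    exact hg.bdd_mul (c := K) (hW2c.comp hHsmooth.continuous).aestronglyMeasurable
      (ae_of_all _ fun z => hK _ (Set.Ioo_subset_Icc_self (hHrange z)))
  have hi12 : Integrable fun z => iteratedDeriv 2 (w y) z * deriv ℍ z -
      w y z * (iteratedDeriv 2 W (ℍ z) * deriv ℍ z) := hi1.sub hi2
  have hbound : ∀ z, ‖fderiv ℝ G (y, z) (0, 1) * deriv ℍ z - w y z * deriv W (ℍ z)‖ ≤
      (M' * ‖((0, 1) : (Fin (n - 1) → ℝ) × ℝ)‖ * C + M * C) * Real.exp (-a * |z|) := fun z => by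
    have hb1 := norm_fderiv_apply_le hM' (0, 1) (y, z)
    have hb2 : ‖w y z‖ ≤ M := hM (y, z)
    calc _ ≤ ‖fderiv ℝ G (y, z) (0, 1)‖ * ‖deriv ℍ z‖ + ‖w y z‖ * ‖deriv W (ℍ z)‖ := by
          rw [← norm_mul, ← norm_mul]
          exact norm_sub_le _ _
      _ ≤ (M' * ‖((0, 1) : (Fin (n - 1) → ℝ) × ℝ)‖) * (C * Real.exp (-a * |z|)) +
          M * (C * Real.exp (-a * |z|)) :=
        add_le_add
          (mul_le_mul hb1 (hdHle z) (norm_nonneg _) ((norm_nonneg _).trans hb1))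
          (mul_le_mul hb2 (hddHle z) (norm_nonneg _) ((norm_nonneg _).trans hb2))
      _ = _ := by ring
  have htend : ∀ l : Filter ℝ, Tendsto (fun t : ℝ => |t|) l atTop → Tendsto
      (fun z => fderiv ℝ G (y, z) (0, 1) * deriv ℍ z - w y z * deriv W (ℍ z)) l (nhds 0) :=
    fun l hl => squeeze_zero_norm hbound
      (by simpa only [mul_zero] using (tendsto_exp_neg_mul_abs ha hl).const_mul _)
  have hparts : ∫ z : ℝ, (iteratedDeriv 2 (w y) z * deriv ℍ z -
      w y z * (iteratedDeriv 2 W (ℍ z) * deriv ℍ z)) = 0 := by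
    rw [integral_of_hasDerivAt_of_tendsto (fun z => ?_) hi12
      (htend _ tendsto_abs_atBot_atTop) (htend _ tendsto_abs_atTop_atTop), sub_zero]
    have h := ((hasDerivAt_vertical_fderiv (G := G) hw y z).mul (hH2 z)).sub
      ((hasDerivAt_vertical (G := G) (hw.differentiable two_ne_zero) y z).mul (hH3 z))
    refine h.congr_deriv ?_
    rw [← iteratedDeriv_two_vertical (G := G) hw]
    change iteratedDeriv 2 (w y) z * deriv ℍ z + fderiv ℝ G (y, z) (0, 1) * deriv W (ℍ z) -
      (fderiv ℝ G (y, z) (0, 1) * deriv W (ℍ z) +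
        w y z * (iteratedDeriv 2 W (ℍ z) * deriv ℍ z)) = _
    ring
  have hlap : ∀ z, lapPi (fun y => G (y, z)) y * deriv ℍ z = f y * deriv ℍ z ^ 2 -
      (iteratedDeriv 2 (w y) z * deriv ℍ z -
        w y z * (iteratedDeriv 2 W (ℍ z) * deriv ℍ z)) := fun z => by
    linear_combination deriv ℍ z * hpde y z
  simp_rw [hlap]
  rw [integral_sub (hsq.const_mul _) hi12, hparts, integral_const_mul, sub_zero, mul_comm]
end

section
/- Let 𝕀 : ℝ → ℝ be a C¹ function with 𝕀 and 𝕀' polynomially bounded, and let 𝕂 : ℝ → ℝ be a C² function such that 𝕂, 𝕂', 𝕂'' are polynomially bounded and 𝕂''(t) − W''(ℍ(t)) 𝕂(t) = 𝕀'(t) for all t. Then ∫_ℝ W'''(ℍ(t)) 𝕂(t) (ℍ'(t))² dt = ∫_ℝ ℍ''(t) 𝕀'(t) dt. -/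
open MeasureTheory Filter

/-- A continuous function decaying exponentially times a continuous function of polynomial growth
is integrable on the line. -/
theorem integrable_mul_of_exp_decay_of_polynomial_growth {f g : ℝ → ℝ} {C D a : ℝ} {m : ℕ}
    (hf : Continuous f) (hg : Continuous g) (ha : 0 < a)
    (hfb : ∀ t, |f t| ≤ C * Real.exp (-a * |t|)) (hgb : ∀ t, |g t| ≤ D * (1 + |t|) ^ m) :
    Integrable fun t => f t * g t := by
  have hC : 0 ≤ C := by simpa using (abs_nonneg _).trans (hfb 0)
  have hD : 0 ≤ D := by simpa using (abs_nonneg _).trans (hgb 0)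
  set B : ℝ := (m + 2).factorial * Real.exp a / a ^ (m + 2)
  refine (integrable_inv_one_add_sq.const_mul (C * D * B)).mono'
    (hf.mul hg).aestronglyMeasurable (Eventually.of_forall fun t => ?_)
  have h0 : 0 ≤ |t| := abs_nonneg t
  have hexp : (1 + |t|) ^ (m + 2) * Real.exp (-a * |t|) ≤ B := by
    have h := Real.pow_div_factorial_le_exp (a * (1 + |t|)) (by positivity) (m + 2)
    rw [div_le_iff₀ (by positivity), mul_pow,
      show a * (1 + |t|) = a + a * |t| by ring, Real.exp_add] at h
    rw [le_div_iff₀ (by positivity), neg_mul, Real.exp_neg, ← div_eq_mul_inv, div_mul_eq_mul_div,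
      div_le_iff₀ (Real.exp_pos _)]
    linarith
  have hpoly : (1 + |t|) ^ m * Real.exp (-a * |t|) ≤ B * (1 + t ^ 2)⁻¹ := by
    rw [← div_eq_mul_inv, le_div_iff₀ (by positivity)]
    refine le_trans ?_ hexp
    rw [pow_add, mul_right_comm]
    gcongr
    nlinarith [sq_abs t]
  calc ‖f t * g t‖ = |f t| * |g t| := by rw [Real.norm_eq_abs, abs_mul]
    _ ≤ (C * Real.exp (-a * |t|)) * (D * (1 + |t|) ^ m) :=
      mul_le_mul (hfb t) (hgb t) (abs_nonneg _) (by positivity)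
    _ = C * D * ((1 + |t|) ^ m * Real.exp (-a * |t|)) := by ring
    _ ≤ C * D * (B * (1 + t ^ 2)⁻¹) := by gcongr
    _ = C * D * B * (1 + t ^ 2)⁻¹ := by ring

/-- A bounded function times a function of polynomial growth has polynomial growth. -/
theorem abs_mul_le_of_bounded_of_polynomial_growth {f g : ℝ → ℝ} {M D : ℝ} {m : ℕ}
    (hf : ∀ t, |f t| ≤ M) (hg : ∀ t, |g t| ≤ D * (1 + |t|) ^ m) (t : ℝ) :
    |f t * g t| ≤ M * D * (1 + |t|) ^ m := by
  rw [abs_mul, mul_assoc]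
  exact mul_le_mul (hf t) (hg t) (abs_nonneg _) ((abs_nonneg _).trans (hf t))

theorem ContDiff.hasDerivAt_iteratedDeriv {f : ℝ → ℝ} {n : WithTop ℕ∞} (hf : ContDiff ℝ n f)
    (k : ℕ) (hk : (k : WithTop ℕ∞) < n) (x : ℝ) :
    HasDerivAt (iteratedDeriv k f) (iteratedDeriv (k + 1) f x) x := by
  rw [iteratedDeriv_succ]
  exact (hf.differentiable_iteratedDeriv k hk x).hasDerivAt

/-- if `𝕂'' − W''(ℍ)𝕂 = 𝕀'` with `𝕀, 𝕀', 𝕂, 𝕂', 𝕂''` polynomially bounded,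
then `∫ W'''(ℍ) 𝕂 (ℍ')² = ∫ ℍ'' 𝕀'`. -/
theorem integral_Wppp_K_eq_integral_Hpp_Iprime
    (W ℍ : ℝ → ℝ)
    (hWsmooth : ContDiff ℝ (⊤ : ℕ∞) W)
    (hWnonneg : ∀ x, 0 ≤ W x)
    (hWzero : ∀ x, W x = 0 ↔ x = 1 ∨ x = -1)
    (hW'zero : deriv W 0 = 0)
    (hW''zero : iteratedDeriv 2 W 0 ≠ 0)
    (hWwell : ∀ x : ℝ, 0 < |x| → |x| < 1 → x * deriv W x < 0)
    (hWconv : ∃ κ > (0:ℝ), ∃ β ∈ Set.Ioo (0:ℝ) 1, ∀ x : ℝ, 1 - β ≤ |x| → κ ≤ iteratedDeriv 2 W x)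
    (hWsymm : ∀ x, W (-x) = W x)
    (hHsmooth : ContDiff ℝ (⊤ : ℕ∞) ℍ)
    (hHrange : ∀ t, ℍ t ∈ Set.Ioo (-1:ℝ) 1)
    (hHode : ∀ t, iteratedDeriv 2 ℍ t = deriv W (ℍ t))
    (hHzero : ℍ 0 = 0)
    (hHmono : ∀ t, 0 < deriv ℍ t)
    (hHtop : Filter.Tendsto ℍ Filter.atTop (nhds 1))
    (hHbot : Filter.Tendsto ℍ Filter.atBot (nhds (-1)))
    (hdecay : ∃ C > (0:ℝ), ∃ a > (0:ℝ), ∀ t : ℝ,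
      |deriv ℍ t| + |iteratedDeriv 2 ℍ t| ≤ C * Real.exp (-a * |t|))
    (𝕀 : ℝ → ℝ) (hI : ContDiff ℝ 1 𝕀)
    (hIpoly : ∃ C' > (0:ℝ), ∃ m : ℕ, ∀ t : ℝ,
      |𝕀 t| + |deriv 𝕀 t| ≤ C' * (1 + |t|) ^ m)
    (𝕂 : ℝ → ℝ) (hK : ContDiff ℝ 2 𝕂)
    (hKpoly : ∃ C' > (0:ℝ), ∃ m : ℕ, ∀ t : ℝ,
      |𝕂 t| + |deriv 𝕂 t| + |iteratedDeriv 2 𝕂 t| ≤ C' * (1 + |t|) ^ m)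
    (hKode : ∀ t : ℝ, iteratedDeriv 2 𝕂 t - iteratedDeriv 2 W (ℍ t) * 𝕂 t = deriv 𝕀 t) :
    (∫ t : ℝ, iteratedDeriv 3 W (ℍ t) * 𝕂 t * (deriv ℍ t) ^ 2)
      = ∫ t : ℝ, iteratedDeriv 2 ℍ t * deriv 𝕀 t := by
  obtain ⟨C, -, a, ha, hH⟩ := hdecay
  obtain ⟨D, -, m, hI'⟩ := hIpoly
  obtain ⟨E, -, n, hK'⟩ := hKpoly
  have hH1 : ∀ t, |deriv ℍ t| ≤ C * Real.exp (-a * |t|) := fun t => by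
    linarith [hH t, abs_nonneg (iteratedDeriv 2 ℍ t)]
  have hH2 : ∀ t, |iteratedDeriv 2 ℍ t| ≤ C * Real.exp (-a * |t|) := fun t => by
    linarith [hH t, abs_nonneg (deriv ℍ t)]
  have hI1 : ∀ t, |deriv 𝕀 t| ≤ D * (1 + |t|) ^ m := fun t => by
    linarith [hI' t, abs_nonneg (𝕀 t)]
  have hK0 : ∀ t, |𝕂 t| ≤ E * (1 + |t|) ^ n := fun t => by
    linarith [hK' t, abs_nonneg (deriv 𝕂 t), abs_nonneg (iteratedDeriv 2 𝕂 t)]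
  have hK1 : ∀ t, |deriv 𝕂 t| ≤ E * (1 + |t|) ^ n := fun t => by
    linarith [hK' t, abs_nonneg (𝕂 t), abs_nonneg (iteratedDeriv 2 𝕂 t)]
  have hlt : ∀ k : ℕ, (k : WithTop ℕ∞) < ((⊤ : ℕ∞) : WithTop ℕ∞) := fun k => by
    exact_mod_cast ENat.natCast_lt_top k
  have hcW : ∀ k, Continuous (iteratedDeriv k W) := fun k =>
    hWsmooth.continuous_iteratedDeriv k (hlt k).le
  have hcWH : ∀ k, Continuous fun t => iteratedDeriv k W (ℍ t) := fun k =>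
    (hcW k).comp hHsmooth.continuous
  have hbW : ∀ k, ∃ M, ∀ t, |iteratedDeriv k W (ℍ t)| ≤ M := fun k => by
    obtain ⟨M, hM⟩ := (isCompact_Icc (a := (-1 : ℝ)) (b := 1)).exists_bound_of_continuousOn
      (hcW k).continuousOn
    exact ⟨M, fun t => hM _ (Set.Ioo_subset_Icc_self (hHrange t))⟩
  have hcH1 : Continuous (deriv ℍ) := by
    simpa using hHsmooth.continuous_iteratedDeriv 1 (hlt 1).le
  have hcH2 : Continuous (iteratedDeriv 2 ℍ) := hHsmooth.continuous_iteratedDeriv 2 (hlt 2).le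
  have hcK1 : Continuous (deriv 𝕂) := hK.continuous_deriv (by norm_num)
  have hcI1 : Continuous (deriv 𝕀) := hI.continuous_deriv le_rfl
  have hbH1 : ∀ t, |deriv ℍ t| ≤ C := fun t => by
    have hC : 0 ≤ C := by simpa using (abs_nonneg _).trans (hH1 0)
    refine (hH1 t).trans (mul_le_of_le_one_right hC (Real.exp_le_one_iff.2 ?_))
    nlinarith [abs_nonneg t]
  obtain ⟨M₂, hM₂⟩ := hbW 2
  obtain ⟨M₃, hM₃⟩ := hbW 3
  have hint_left : Integrable fun t => iteratedDeriv 3 W (ℍ t) * 𝕂 t * deriv ℍ t ^ 2 := by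
    refine (integrable_mul_of_exp_decay_of_polynomial_growth hcH1
      (hcH1.mul ((hcWH 3).mul hK.continuous)) ha hH1
      (abs_mul_le_of_bounded_of_polynomial_growth hbH1
        (abs_mul_le_of_bounded_of_polynomial_growth hM₃ hK0))).congr
      (Eventually.of_forall fun t => ?_)
    simp only [Pi.mul_apply]
    ring
  have hint_right : Integrable fun t => iteratedDeriv 2 ℍ t * deriv 𝕀 t :=
    integrable_mul_of_exp_decay_of_polynomial_growth hcH2 hcI1 ha hH2 hI1
  have hint_wronskian : Integrable fun t => iteratedDeriv 2 ℍ t * deriv 𝕂 t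
      - deriv ℍ t * (iteratedDeriv 2 W (ℍ t) * 𝕂 t) :=
    (integrable_mul_of_exp_decay_of_polynomial_growth hcH2 hcK1 ha hH2 hK1).sub
      (integrable_mul_of_exp_decay_of_polynomial_growth hcH1 ((hcWH 2).mul hK.continuous) ha hH1
        (abs_mul_le_of_bounded_of_polynomial_growth hM₂ hK0))
  have hderiv : ∀ t, HasDerivAt (fun t => iteratedDeriv 2 ℍ t * deriv 𝕂 t
      - deriv ℍ t * (iteratedDeriv 2 W (ℍ t) * 𝕂 t))
      (iteratedDeriv 2 ℍ t * deriv 𝕀 t - iteratedDeriv 3 W (ℍ t) * 𝕂 t * deriv ℍ t ^ 2) t := by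
    intro t
    have hH0 : HasDerivAt ℍ (deriv ℍ t) t := by
      simpa using hHsmooth.hasDerivAt_iteratedDeriv 0 (hlt 0) t
    have hH1 : HasDerivAt (deriv ℍ) (iteratedDeriv 2 ℍ t) t := by
      simpa using hHsmooth.hasDerivAt_iteratedDeriv 1 (hlt 1) t
    have hW1 : HasDerivAt (deriv W) (iteratedDeriv 2 W (ℍ t)) (ℍ t) := by
      simpa using hWsmooth.hasDerivAt_iteratedDeriv 1 (hlt 1) (ℍ t)
    have hH2 : HasDerivAt (iteratedDeriv 2 ℍ) (iteratedDeriv 2 W (ℍ t) * deriv ℍ t) t := by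
      rw [funext hHode]
      exact hW1.comp t hH0
    have hW2 : HasDerivAt (fun t => iteratedDeriv 2 W (ℍ t))
        (iteratedDeriv 3 W (ℍ t) * deriv ℍ t) t :=
      (hWsmooth.hasDerivAt_iteratedDeriv 2 (hlt 2) (ℍ t)).comp t hH0
    have hK0 : HasDerivAt 𝕂 (deriv 𝕂 t) t := (hK.differentiable (by norm_num) t).hasDerivAt
    have hK1 : HasDerivAt (deriv 𝕂) (iteratedDeriv 2 𝕂 t) t := by
      simpa using hK.hasDerivAt_iteratedDeriv 1 (by norm_num) t
    refine ((hH2.mul hK1).sub (hH1.mul (hW2.mul hK0))).congr_deriv ?_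
    rw [← hKode t]
    simp only [Pi.mul_apply]
    ring
  have hzero := integral_eq_zero_of_hasDerivAt_of_integrable hderiv
    (hint_right.sub hint_left) hint_wronskian
  rw [integral_sub hint_right hint_left] at hzero
  linarith
end
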